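/- Over ℂ, for α₁, β₁, β₂ ∈ ℂ let A₂(α₁,β₁,β₂) be the 2×4 matrix with rows (α₁, 0, 0, 1) and (β₁, β₂, 1−α₁, 0). Then the 2×8 matrix T(A₂(α₁,β₁,β₂)) = A₂(α₁,β₁,β₂)·(I₂ ⊗ A₂(α₁,β₁,β₂)) is totally associative if and only if (α₁, β₁, β₂) is one of (0, 0, 0), (1/2, 0, −1/2), (1/2, 0, 1/2). -/

import Mathlib

open Matrix Kronecker

/-- Kronecker product of `Fin`-indexed matrices, with row/column blocks ordered
lexicographically via `finProdFinEquiv`: for 2x2-block factors the columns of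
`kron A B` appear in the order (1,1),(1,2),(2,1),(2,2). -/
def kron {F : Type*} [Mul F] {a b c d : ℕ}
    (A : Matrix (Fin a) (Fin b) F) (B : Matrix (Fin c) (Fin d) F) :
    Matrix (Fin (a * c)) (Fin (b * d)) F :=
  Matrix.reindex finProdFinEquiv finProdFinEquiv (A ⊗ₖ B)

/-- MSC of the ternary multiplication f(x,y,z) = x·(y·z) generated by the binary
algebra with MSC `A`, namely T(A) = A·(I₂ ⊗ A), a 2×8 matrix. -/
def T {F : Type*} [Field F] (A : Matrix (Fin 2) (Fin 4) F) : Matrix (Fin 2) (Fin 8) F :=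
  A * kron (1 : Matrix (Fin 2) (Fin 2) F) A

/-- A 2×8 MSC `B` is totally associative if
B·(B ⊗ I₂ ⊗ I₂) = B·(I₂ ⊗ B ⊗ I₂) = B·(I₂ ⊗ I₂ ⊗ B). -/
def TotAssoc (B : Matrix (Fin 2) (Fin 8) ℂ) : Prop :=
  B * kron (kron B (1 : Matrix (Fin 2) (Fin 2) ℂ)) (1 : Matrix (Fin 2) (Fin 2) ℂ) =
      B * kron (kron (1 : Matrix (Fin 2) (Fin 2) ℂ) B) (1 : Matrix (Fin 2) (Fin 2) ℂ) ∧
    B * kron (kron (1 : Matrix (Fin 2) (Fin 2) ℂ) B) (1 : Matrix (Fin 2) (Fin 2) ℂ) =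
      B * kron (kron (1 : Matrix (Fin 2) (Fin 2) ℂ) (1 : Matrix (Fin 2) (Fin 2) ℂ)) B


@[simp]
theorem kron_apply_finProdFinEquiv {F : Type*} [Mul F] {a b c d : ℕ}
    (A : Matrix (Fin a) (Fin b) F) (B : Matrix (Fin c) (Fin d) F)
    (i : Fin a) (k : Fin c) (j : Fin b) (l : Fin d) :
    kron A B (finProdFinEquiv (i, k)) (finProdFinEquiv (j, l)) = A i j * B k l := by
  simp [kron]

theorem mul_kron_apply {F : Type*} [NonUnitalNonAssocSemiring F] {m a b c d : ℕ}
    (M : Matrix (Fin m) (Fin (a * c)) F) (A : Matrix (Fin a) (Fin b) F)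
    (B : Matrix (Fin c) (Fin d) F) (i : Fin m) (j : Fin b) (l : Fin d) :
    (M * kron A B) i (finProdFinEquiv (j, l)) =
      ∑ p, ∑ q, M i (finProdFinEquiv (p, q)) * (A p j * B q l) := by
  rw [Matrix.mul_apply, ← finProdFinEquiv.sum_comp, Fintype.sum_prod_type]
  simp

theorem mul_kron_kron_apply {F : Type*} [NonUnitalNonAssocSemiring F] {m a b c d e f : ℕ}
    (M : Matrix (Fin m) (Fin (a * c * e)) F) (A : Matrix (Fin a) (Fin b) F)
    (B : Matrix (Fin c) (Fin d) F) (C : Matrix (Fin e) (Fin f) F)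
    (i : Fin m) (j : Fin b) (k : Fin d) (l : Fin f) :
    (M * kron (kron A B) C) i (finProdFinEquiv (finProdFinEquiv (j, k), l)) =
      ∑ p, ∑ q, ∑ r,
        M i (finProdFinEquiv (finProdFinEquiv (p, q), r)) * (A p j * B q k * C r l) := by
  rw [mul_kron_apply, ← finProdFinEquiv.sum_comp, Fintype.sum_prod_type]
  simp

/-- The position of the triple `(x, y, z)` among the columns of a 2×8 MSC. -/
def tripleIdx (x y z : Fin 2) : Fin 8 :=
  finProdFinEquiv ((finProdFinEquiv (x, y) : Fin (2 * 2)), z)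

/-- The position of a 5-tuple among the columns of the products in `TotAssoc`. -/
def quintIdx (v w x y z : Fin 2) : Fin 32 :=
  finProdFinEquiv ((finProdFinEquiv (tripleIdx v w x, y) : Fin (8 * 2)), z)

theorem quintIdx_eq_middle (v w x y z : Fin 2) :
    quintIdx v w x y z =
      finProdFinEquiv ((finProdFinEquiv (v, tripleIdx w x y) : Fin (2 * 8)), z) := by
  revert v w x y z; decide

theorem quintIdx_eq_right (v w x y z : Fin 2) :
    quintIdx v w x y z =
      finProdFinEquiv ((finProdFinEquiv (v, w) : Fin (2 * 2)), tripleIdx x y z) := by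
  revert v w x y z; decide

theorem exists_quintIdx_eq (j : Fin 32) : ∃ v w x y z, quintIdx v w x y z = j := by
  revert j; decide

section Entries

variable {F : Type*} [Semiring F] (B : Matrix (Fin 2) (Fin 8) F) (i v w x y z : Fin 2)

theorem mul_kron_left_apply :
    (B * kron (kron B (1 : Matrix (Fin 2) (Fin 2) F)) (1 : Matrix (Fin 2) (Fin 2) F) :
      Matrix (Fin 2) (Fin 32) F) i (quintIdx v w x y z) =
      ∑ p, B i (tripleIdx p y z) * B p (tripleIdx v w x) := by
  refine (mul_kron_kron_apply (a := 2) (c := 2) (e := 2) B _ _ _ i _ _ _).trans ?_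
  simp [Matrix.one_apply, tripleIdx, -Fin.sum_univ_two]

theorem mul_kron_middle_apply :
    (B * kron (kron (1 : Matrix (Fin 2) (Fin 2) F) B) (1 : Matrix (Fin 2) (Fin 2) F) :
      Matrix (Fin 2) (Fin 32) F) i (quintIdx v w x y z) =
      ∑ p, B i (tripleIdx v p z) * B p (tripleIdx w x y) := by
  rw [quintIdx_eq_middle]
  refine (mul_kron_kron_apply (a := 2) (c := 2) (e := 2) B _ _ _ i _ _ _).trans ?_
  simp [Matrix.one_apply, tripleIdx, -Fin.sum_univ_two]

theorem mul_kron_right_apply :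
    (B * kron (kron (1 : Matrix (Fin 2) (Fin 2) F) (1 : Matrix (Fin 2) (Fin 2) F)) B :
      Matrix (Fin 2) (Fin 32) F) i (quintIdx v w x y z) =
      ∑ p, B i (tripleIdx v w p) * B p (tripleIdx x y z) := by
  rw [quintIdx_eq_right]
  refine (mul_kron_kron_apply (a := 2) (c := 2) (e := 2) B _ _ _ i _ _ _).trans ?_
  simp [Matrix.one_apply, tripleIdx, -Fin.sum_univ_two]

end Entries

theorem totAssoc_iff (B : Matrix (Fin 2) (Fin 8) ℂ) :
    TotAssoc B ↔ ∀ i v w x y z : Fin 2,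
      ∑ p, B i (tripleIdx p y z) * B p (tripleIdx v w x) =
        ∑ p, B i (tripleIdx v p z) * B p (tripleIdx w x y) ∧
      ∑ p, B i (tripleIdx v p z) * B p (tripleIdx w x y) =
        ∑ p, B i (tripleIdx v w p) * B p (tripleIdx x y z) := by
  simp only [← mul_kron_left_apply, ← mul_kron_middle_apply, ← mul_kron_right_apply]
  constructor
  · rintro ⟨h₁, h₂⟩ i v w x y z
    exact ⟨congrFun (congrFun h₁ i) _, congrFun (congrFun h₂ i) _⟩
  · intro h
    constructor <;> ext i j <;> obtain ⟨v, w, x, y, z, rfl⟩ := exists_quintIdx_eq j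
    · exact (h i v w x y z).1
    · exact (h i v w x y z).2

theorem T_apply_tripleIdx {F : Type*} [Field F] (A : Matrix (Fin 2) (Fin 4) F)
    (i x y z : Fin 2) :
    T A i (tripleIdx x y z) =
      ∑ q, A i (finProdFinEquiv (x, q) : Fin (2 * 2)) *
        A q (finProdFinEquiv (y, z) : Fin (2 * 2)) := by
  have h : tripleIdx x y z = finProdFinEquiv (x, (finProdFinEquiv (y, z) : Fin (2 * 2))) := by
    revert x y z; decide
  rw [h]
  refine (mul_kron_apply (a := 2) (c := 2) A _ _ i _ _).trans ?_
  simp [Matrix.one_apply, -Fin.sum_univ_two]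

section A2

variable {F : Type*} [Field F] (a b c : F)

theorem T_A2_tripleIdx (i x y z : Fin 2) :
    T !![a, 0, 0, 1; b, c, 1 - a, 0] i (tripleIdx x y z) =
      ![![![![a ^ 2, 0], ![0, a]], ![![b, c], ![1 - a, 0]]],
        ![![![a * b + b * c, c ^ 2], ![(1 - a) * c, b]],
          ![![(1 - a) * a, 0], ![0, 1 - a]]]] i x y z := by
  have h00 : (finProdFinEquiv ((0 : Fin 2), (0 : Fin 2)) : Fin 4) = 0 := by decide
  have h01 : (finProdFinEquiv ((0 : Fin 2), (1 : Fin 2)) : Fin 4) = 1 := by decide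
  have h10 : (finProdFinEquiv ((1 : Fin 2), (0 : Fin 2)) : Fin 4) = 2 := by decide
  have h11 : (finProdFinEquiv ((1 : Fin 2), (1 : Fin 2)) : Fin 4) = 3 := by decide
  rw [T_apply_tripleIdx, Fin.sum_univ_two]
  fin_cases i <;> fin_cases x <;> fin_cases y <;> fin_cases z <;>
    simp [h00, h01, h10, h11] <;> ring

end A2

/-- T(A₂(α₁,β₁,β₂)) is totally associative iff
(α₁,β₁,β₂) ∈ {(0,0,0), (1/2,0,−1/2), (1/2,0,1/2)}. -/
theorem totAssoc_T_A2_iff (α1 β1 β2 : ℂ) :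
    TotAssoc (T !![α1, 0, 0, 1;
                   β1, β2, 1 - α1, 0]) ↔
      (α1, β1, β2) = (0, 0, 0) ∨
        (α1, β1, β2) = (1/2, 0, -(1/2)) ∨
        (α1, β1, β2) = (1/2, 0, 1/2) := by
  simp only [totAssoc_iff, T_A2_tripleIdx, Fin.sum_univ_two]
  constructor
  · intro h
    have h₁ := (h 0 0 1 1 1 1).1
    have h₂ := (h 0 1 0 1 1 0).1
    have h₃ := (h 0 1 1 0 1 1).1
    simp at h₁ h₂ h₃
    obtain rfl : β1 = 0 := by linear_combination -h₂
    simp only [Prod.mk.injEq, true_and]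
    rcases h₁ with h₁ | rfl
    · obtain rfl : α1 = 1 / 2 := by linear_combination h₁ / 2
      have h₄ : (β2 + 1 / 2) * (β2 - 1 / 2) = 0 := by linear_combination -h₃
      rcases mul_eq_zero.mp h₄ with h₅ | h₅
      · exact Or.inr (Or.inl ⟨rfl, by linear_combination h₅⟩)
      · exact Or.inr (Or.inr ⟨rfl, by linear_combination h₅⟩)
    · exact Or.inl ⟨rfl, by simpa using h₃⟩
  · simp only [Prod.mk.injEq]
    rintro (⟨rfl, rfl, rfl⟩ | ⟨rfl, rfl, rfl⟩ | ⟨rfl, rfl, rfl⟩) <;>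
      simp only [Fin.forall_fin_two] <;> norm_num
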